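/- Let n ≥ 1 and let f : ℝⁿ → ℝ be a smooth function satisfying the graphical self-shrinker equation ∑_{i,j=1}^n (δ_{ij} − ∂_i f(x) ∂_j f(x)/(1+|∇f(x)|²)) ∂²_{ij} f(x) = (1/2)(x·∇f(x) − f(x)) for every x ∈ ℝⁿ. Then ‖∇f‖ is constant on ℝⁿ; equivalently, the vertical component w(x) = (1 + |∇f(x)|²)^{−1/2} of the upward unit normal of the graph is constant. -/

import Mathlib

/-- The `i`-th partial derivative of `f : ℝⁿ → ℝ` at `x`. -/
noncomputable def pd {n : ℕ} (f : EuclideanSpace ℝ (Fin n) → ℝ) (i : Fin n)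
    (x : EuclideanSpace ℝ (Fin n)) : ℝ :=
  fderiv ℝ f x (EuclideanSpace.single i 1)

/-- The second partial derivative `∂²_{ij} f` at `x`. -/
noncomputable def pd2 {n : ℕ} (f : EuclideanSpace ℝ (Fin n) → ℝ) (i j : Fin n)
    (x : EuclideanSpace ℝ (Fin n)) : ℝ :=
  pd (fun y => pd f j y) i x

/-- The inverse induced metric `g^{ij} = δ_{ij} − ∂_i f ∂_j f / (1 + |∇f|²)` of the graph of `f`. -/
noncomputable def gInv {n : ℕ} (f : EuclideanSpace ℝ (Fin n) → ℝ) (i j : Fin n)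
    (x : EuclideanSpace ℝ (Fin n)) : ℝ :=
  (if i = j then 1 else 0) - pd f i x * pd f j x / (1 + ∑ k, (pd f k x) ^ 2)

open Filter Topology Matrix

section Calculus

variable {n : ℕ}

local notation "E" => EuclideanSpace ℝ (Fin n)

lemma hasDerivAt_pd {φ : E → ℝ} {x : E} (hφ : DifferentiableAt ℝ φ x) (i : Fin n) :
    HasDerivAt (fun t : ℝ => φ (x + t • EuclideanSpace.single i 1)) (pd φ i x) 0 :=
  hφ.hasFDerivAt.hasLineDerivAt _

lemma pd_eq_of_hasDerivAt {φ : E → ℝ} {x : E} (hφ : DifferentiableAt ℝ φ x) {i : Fin n} {d : ℝ}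
    (h : HasDerivAt (fun t : ℝ => φ (x + t • EuclideanSpace.single i 1)) d 0) : pd φ i x = d :=
  (hasDerivAt_pd hφ i).unique h

lemma contDiff_pd {φ : E → ℝ} (hφ : ContDiff ℝ (⊤ : ℕ∞) φ) (i : Fin n) :
    ContDiff ℝ (⊤ : ℕ∞) (pd φ i) :=
  (hφ.fderiv_right (m := ((⊤ : ℕ∞) : WithTop ℕ∞)) (by simp)).clm_apply contDiff_const

lemma ContDiff.differentiableAt_of_top {φ : E → ℝ} (hφ : ContDiff ℝ (⊤ : ℕ∞) φ) (x : E) :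
    DifferentiableAt ℝ φ x :=
  hφ.differentiable (by simp) x

lemma fderiv_eq_sum_pd (φ : E → ℝ) (x v : E) : fderiv ℝ φ x v = ∑ i, v i * pd φ i x := by
  conv_lhs => rw [← (EuclideanSpace.basisFun (Fin n) ℝ).sum_repr v]
  simp [pd]

lemma pd2_comm {φ : E → ℝ} (hφ : ContDiff ℝ (⊤ : ℕ∞) φ) (i j : Fin n) (x : E) :
    pd2 φ i j x = pd2 φ j i x := by
  have key : ∀ i j, pd2 φ i j x =
      fderiv ℝ (fderiv ℝ φ) x (EuclideanSpace.single i 1) (EuclideanSpace.single j 1) := by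
    intro i j
    have hd : DifferentiableAt ℝ (fderiv ℝ φ) x :=
      (hφ.fderiv_right (m := ((⊤ : ℕ∞) : WithTop ℕ∞)) (by simp)).differentiable (by simp) x
    have := (hd.hasFDerivAt.clm_apply
      (hasFDerivAt_const (EuclideanSpace.single j (1 : ℝ)) x)).fderiv
    unfold pd2 pd
    rw [this]
    simp
  rw [key, key]
  exact (hφ.contDiffAt.isSymmSndFDerivAt (by simp; exact WithTop.coe_le_coe.mpr le_top)) _ _

/-- `L φ = ∑ a_{ij} ∂²_{ij} φ - ½ x · ∇φ`. -/
noncomputable def driftOp (a : E → Fin n → Fin n → ℝ) (φ : E → ℝ) (x : E) : ℝ :=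
  ∑ i, ∑ j, a x i j * pd2 φ i j x - (1 / 2) * ∑ i, x i * pd φ i x

lemma pd_add_const_mul {φ ψ : E → ℝ} {x : E} (hφ : DifferentiableAt ℝ φ x)
    (hψ : DifferentiableAt ℝ ψ x) (c : ℝ) (i : Fin n) :
    pd (fun y => φ y + c * ψ y) i x = pd φ i x + c * pd ψ i x :=
  pd_eq_of_hasDerivAt (hφ.add (hψ.const_mul c))
    ((hasDerivAt_pd hφ i).add ((hasDerivAt_pd hψ i).const_mul c))

lemma driftOp_add_const_mul (a : E → Fin n → Fin n → ℝ) {φ ψ : E → ℝ}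
    (hφ : ContDiff ℝ (⊤ : ℕ∞) φ) (hψ : ContDiff ℝ (⊤ : ℕ∞) ψ) (c : ℝ) (x : E) :
    driftOp a (fun y => φ y + c * ψ y) x = driftOp a φ x + c * driftOp a ψ x := by
  have h1 : ∀ j, pd (fun y => φ y + c * ψ y) j = fun y => pd φ j y + c * pd ψ j y := fun j =>
    funext fun y => pd_add_const_mul (hφ.differentiableAt_of_top y)
      (hψ.differentiableAt_of_top y) c j
  have h2 : ∀ i j, pd2 (fun y => φ y + c * ψ y) i j x = pd2 φ i j x + c * pd2 ψ i j x := by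
    intro i j
    unfold pd2
    rw [h1]
    exact pd_add_const_mul ((contDiff_pd hφ j).differentiableAt_of_top x)
      ((contDiff_pd hψ j).differentiableAt_of_top x) c i
  simp only [driftOp, h1, h2, mul_add, Finset.sum_add_distrib, Finset.mul_sum, mul_sub]
  have e1 : ∀ i j, a x i j * (c * pd2 ψ i j x) = c * (a x i j * pd2 ψ i j x) := by intros; ring
  have e2 : ∀ i, 1 / 2 * (x i * (c * pd ψ i x)) = c * (1 / 2 * (x i * pd ψ i x)) := by
    intros; ring
  simp only [e1, e2]
  ring

lemma driftOp_sum (a : E → Fin n → Fin n → ℝ) {ι : Type*} (s : Finset ι) {φ : ι → E → ℝ}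
    (hφ : ∀ k, ContDiff ℝ (⊤ : ℕ∞) (φ k)) (x : E) :
    driftOp a (fun y => ∑ k ∈ s, φ k y) x = ∑ k ∈ s, driftOp a (φ k) x := by
  classical
  induction s using Finset.induction_on with
  | empty => simp [driftOp, pd2, pd]
  | insert k s hk ih =>
    have := driftOp_add_const_mul a (hφ k) (ContDiff.sum fun l (_ : l ∈ s) => hφ l) 1 x
    simp only [one_mul] at this
    simp only [Finset.sum_insert hk, this, ih]

lemma pd_comp {F : ℝ → ℝ} {u : E → ℝ} {x : E} {d : ℝ} (hu : DifferentiableAt ℝ u x)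
    (hF : HasDerivAt F d (u x)) (i : Fin n) :
    pd (fun y => F (u y)) i x = d * pd u i x := by
  simp only [pd]
  have := (hF.comp_hasFDerivAt x hu.hasFDerivAt).fderiv
  rw [Function.comp_def] at this
  rw [this]
  simp

lemma driftOp_comp (a : E → Fin n → Fin n → ℝ) {F F' : ℝ → ℝ} {F'' : ℝ} {u : E → ℝ} {x : E}
    (hu : ContDiff ℝ (⊤ : ℕ∞) u) (hF : ∀ y, HasDerivAt F (F' (u y)) (u y))
    (hF' : HasDerivAt F' F'' (u x)) :
    driftOp a (fun y => F (u y)) x =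
      F' (u x) * driftOp a u x + F'' * ∑ i, ∑ j, a x i j * (pd u i x * pd u j x) := by
  have h1 : ∀ j, pd (fun y => F (u y)) j = fun y => F' (u y) * pd u j y := fun j =>
    funext fun y => pd_comp (hu.differentiableAt_of_top y) (hF y) j
  have hux := hu.differentiableAt_of_top x
  have h2 : ∀ i j, pd2 (fun y => F (u y)) i j x =
      F'' * pd u i x * pd u j x + F' (u x) * pd2 u i j x := by
    intro i j
    unfold pd2
    rw [h1]
    have hcomp : DifferentiableAt ℝ (fun y => F' (u y)) x :=
      (hF'.comp_hasFDerivAt x hux.hasFDerivAt).differentiableAt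
    have hpd := (contDiff_pd hu j).differentiableAt_of_top x
    refine pd_eq_of_hasDerivAt (hcomp.mul hpd) ?_
    have := (hasDerivAt_pd hcomp i).fun_mul (hasDerivAt_pd hpd i)
    simpa [pd_comp hux hF'] using this
  simp only [driftOp, h1, h2, mul_add, Finset.sum_add_distrib, Finset.mul_sum, mul_sub]
  have e1 : ∀ i j, a x i j * (F'' * pd u i x * pd u j x) =
    F'' * (a x i j * (pd u i x * pd u j x)) := by intros; ring
  have e2 : ∀ i, 1 / 2 * (x i * (F' (u x) * pd u i x)) = F' (u x) * (1 / 2 * (x i * pd u i x)) := by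
    intros; ring
  have e3 : ∀ i j, a x i j * (F' (u x) * pd2 u i j x) = F' (u x) * (a x i j * pd2 u i j x) := by
    intros; ring
  simp only [e1, e2, e3]
  ring

lemma Matrix.PosSemidef.exists_eq_sum {A : Matrix (Fin n) (Fin n) ℝ} (hA : A.PosSemidef) :
    ∃ B : Matrix (Fin n) (Fin n) ℝ, ∀ i j, A i j = ∑ k, B k i * B k j := by
  open scoped MatrixOrder Matrix.Norms.L2Operator in
  obtain ⟨B, hB⟩ := CStarAlgebra.nonneg_iff_eq_star_mul_self.mp hA.nonneg
  exact ⟨B, fun i j => by simp [hB, Matrix.mul_apply, Matrix.star_apply]⟩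

lemma IsLocalMin.sum_sum_pd2_nonneg {φ : E → ℝ} (hφ : ContDiff ℝ (⊤ : ℕ∞) φ) {x : E}
    (hx : IsLocalMin φ x) (v : Fin n → ℝ) : 0 ≤ ∑ i, ∑ j, v i * v j * pd2 φ i j x := by
  set V : E := WithLp.toLp 2 v with hV
  set g : ℝ → ℝ := fun t => φ (x + t • V) with hg
  have hline : ∀ t : ℝ, HasDerivAt (fun t : ℝ => x + t • V) V t := fun t => by
    simpa using ((hasDerivAt_id t).smul_const V).const_add x
  have hder : ∀ (ψ : E → ℝ), ContDiff ℝ (⊤ : ℕ∞) ψ → ∀ t : ℝ,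
      HasDerivAt (fun t : ℝ => ψ (x + t • V)) (∑ i, v i * pd ψ i (x + t • V)) t := by
    intro ψ hψ t
    have := (hψ.differentiableAt_of_top (x + t • V)).hasFDerivAt.comp_hasDerivAt t (hline t)
    rwa [fderiv_eq_sum_pd] at this
  have hg1 : deriv g = fun t => ∑ i, v i * pd φ i (x + t • V) :=
    funext fun t => (hder φ hφ t).deriv
  have hg2 : deriv (deriv g) 0 = ∑ i, ∑ j, v i * v j * pd2 φ i j x := by
    rw [hg1, (HasDerivAt.fun_sum fun i (_ : i ∈ Finset.univ) =>
      (hder _ (contDiff_pd hφ i) 0).const_mul (v i)).deriv]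
    simp only [Finset.mul_sum]
    rw [Finset.sum_comm]
    refine Finset.sum_congr rfl fun i _ => Finset.sum_congr rfl fun j _ => ?_
    simp only [pd2, zero_smul, add_zero]
    ring
  have hmin : IsLocalMin g 0 := by
    have hc : ContinuousAt (fun t : ℝ => x + t • V) 0 := (hline 0).continuousAt
    have : IsLocalMin φ (x + (0 : ℝ) • V) := by simpa using hx
    exact IsLocalMin.comp_continuous (g := fun t : ℝ => x + t • V) this hc
  rw [← hg2]
  by_contra! hneg
  have hmax := isLocalMax_of_deriv_deriv_neg hneg hmin.deriv_eq_zero (hder φ hφ 0).continuousAt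
  have hconst : g =ᶠ[𝓝 0] fun _ => g 0 := by
    filter_upwards [hmin, hmax] with t h1 h2 using le_antisymm h2 h1
  have : deriv (deriv g) 0 = 0 := by
    rw [hconst.deriv.deriv_eq]
    simp
  linarith

lemma IsLocalMin.driftOp_nonneg {a : E → Fin n → Fin n → ℝ} {φ : E → ℝ}
    (hφ : ContDiff ℝ (⊤ : ℕ∞) φ) {x : E} (ha : (Matrix.of (a x)).PosSemidef)
    (hx : IsLocalMin φ x) : 0 ≤ driftOp a φ x := by
  obtain ⟨B, hB⟩ := ha.exists_eq_sum
  have h0 : ∀ i, pd φ i x = 0 := fun i => by simp [pd, hx.fderiv_eq_zero]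
  have : driftOp a φ x = ∑ k, ∑ i, ∑ j, B k i * B k j * pd2 φ i j x := by
    simp only [Matrix.of_apply] at hB
    simp only [driftOp, h0, mul_zero, Finset.sum_const_zero, sub_zero, hB, Finset.sum_mul]
    rw [Finset.sum_comm (s := Finset.univ) (t := Finset.univ)
      (f := fun k i => ∑ j, B k i * B k j * pd2 φ i j x)]
    exact Finset.sum_congr rfl fun i _ => Finset.sum_comm
  rw [this]
  exact Finset.sum_nonneg fun k _ => hx.sum_sum_pd2_nonneg hφ (B k)

lemma pd_norm_sub_sq (q x : E) (i : Fin n) : pd (fun y => ‖y - q‖ ^ 2) i x = 2 * (x i - q i) := by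
  have h : HasFDerivAt (fun y : E => ‖y - q‖ ^ 2) _ x :=
    ((hasFDerivAt_id x).sub_const q).norm_sq
  simp only [pd, h.fderiv]
  simp [EuclideanSpace.inner_single_right]

lemma contDiff_norm_sub_sq (q : E) : ContDiff ℝ (⊤ : ℕ∞) fun y : E => ‖y - q‖ ^ 2 :=
  (contDiff_id.sub contDiff_const).norm_sq ℝ

lemma driftOp_norm_sub_sq (a : E → Fin n → Fin n → ℝ) (q x : E) :
    driftOp a (fun y => ‖y - q‖ ^ 2) x = 2 * ∑ i, a x i i - ∑ i, x i * (x i - q i) := by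
  have h2 : ∀ i j, pd2 (fun y => ‖y - q‖ ^ 2) i j x = if i = j then 2 else 0 := by
    intro i j
    have h : HasFDerivAt (fun y : E => 2 * (y j - q j)) _ x :=
      ((((EuclideanSpace.proj (𝕜 := ℝ) j).hasFDerivAt (x := x)).sub_const (q j)).const_mul 2)
    simp only [pd2, pd_norm_sub_sq]
    simp only [pd, h.fderiv]
    simp [eq_comm]
  simp only [driftOp, h2, pd_norm_sub_sq]
  simp only [mul_ite, mul_zero, Finset.sum_ite_eq, Finset.mem_univ, if_true, Finset.mul_sum]
  congr 1
  · exact Finset.sum_congr rfl fun i _ => mul_comm _ _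
  · exact Finset.sum_congr rfl fun i _ => by ring

/-- A nonnegative supersolution attains its minimum, since `‖x‖²` is a proper function which is a
strict supersolution near infinity. -/
lemma exists_forall_le_of_driftOp_nonpos {a : E → Fin n → Fin n → ℝ} {C : ℝ} {w : E → ℝ}
    (ha : ∀ x, (Matrix.of (a x)).PosSemidef) (htr : ∀ x, ∑ i, a x i i ≤ C)
    (hw : ContDiff ℝ (⊤ : ℕ∞) w) (hw0 : ∀ x, 0 ≤ w x) (hL : ∀ x, driftOp a w x ≤ 0) :
    ∃ x, ∀ y, w x ≤ w y := by
  set R : ℝ := |2 * C| + 1 with hR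
  have hR1 : 1 ≤ R := by simp [hR]
  obtain ⟨x₀, -, hx₀⟩ := (isCompact_closedBall (0 : E) R).exists_isMinOn
    ⟨0, Metric.mem_closedBall_self (by linarith)⟩ hw.continuous.continuousOn
  refine ⟨x₀, fun y => ?_⟩
  have key : ∀ ε > 0, w x₀ ≤ w y + ε * ‖y‖ ^ 2 := by
    intro ε hε
    have hsm : ContDiff ℝ (⊤ : ℕ∞) fun y => w y + ε * ‖y - 0‖ ^ 2 :=
      hw.add (contDiff_const.mul (contDiff_norm_sub_sq 0))
    have hlim : Tendsto (fun y => w y + ε * ‖y - 0‖ ^ 2) (cocompact E) atTop := by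
      refine tendsto_atTop_mono (f := fun y => ε * ‖y‖ ^ 2) (fun y => by simpa using hw0 y) ?_
      exact ((tendsto_pow_atTop two_ne_zero).comp (tendsto_norm_cocompact_atTop)).const_mul_atTop
        hε
    obtain ⟨z, hz⟩ := hsm.continuous.exists_forall_le hlim
    have hloc := IsLocalMin.driftOp_nonneg hsm (ha z) (Eventually.of_forall hz)
    rw [driftOp_add_const_mul a hw (contDiff_norm_sub_sq 0), driftOp_norm_sub_sq] at hloc
    have hsq : ∑ i, z i * (z i - (0 : E) i) = ‖z‖ ^ 2 := by
      simp [EuclideanSpace.real_norm_sq_eq, ← sq]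
    rw [hsq] at hloc
    have hzR : ‖z‖ ≤ R := by
      by_contra! h
      have h1 : 0 ≤ ε * (2 * ∑ i, a z i i - ‖z‖ ^ 2) := by linarith [hL z]
      have h2 := nonneg_of_mul_nonneg_right h1 hε
      nlinarith [htr z, le_abs_self (2 * C)]
    have h1 : w x₀ ≤ w z := hx₀ (by simpa using hzR)
    have h2 := hz y
    simp only [sub_zero] at h2
    nlinarith [mul_nonneg hε.le (sq_nonneg ‖z‖)]
  have hlim : Tendsto (fun ε : ℝ => w y + ε * ‖y‖ ^ 2) (𝓝[>] 0) (𝓝 (w y)) := by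
    have : Continuous fun ε : ℝ => w y + ε * ‖y‖ ^ 2 := by fun_prop
    simpa using (this.tendsto 0).mono_left nhdsWithin_le_nhds
  exact ge_of_tendsto hlim (by filter_upwards [self_mem_nhdsWithin] with ε hε using key ε hε)

lemma driftOp_exp_norm_sub_sq (a : E → Fin n → Fin n → ℝ) (α : ℝ) (q x : E) :
    driftOp a (fun y => Real.exp (-α * ‖y - q‖ ^ 2)) x = α * Real.exp (-α * ‖x - q‖ ^ 2) *
      (α * ∑ i, ∑ j, a x i j * (2 * (x i - q i) * (2 * (x j - q j))) -
        (2 * ∑ i, a x i i - ∑ i, x i * (x i - q i))) := by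
  have hF : ∀ t, HasDerivAt (fun t => Real.exp (-α * t)) (-α * Real.exp (-α * t)) t := fun t => by
    have := ((hasDerivAt_id t).const_mul (-α)).exp
    rwa [mul_one, mul_comm] at this
  rw [driftOp_comp a (F := fun t => Real.exp (-α * t)) (contDiff_norm_sub_sq q) (fun y => hF _)
    ((hF _).const_mul (-α)), driftOp_norm_sub_sq]
  simp only [pd_norm_sub_sq]
  ring

/-- The strong minimum principle: Hopf's barrier `exp (-α ‖x - q‖²)`. -/
lemma eq_of_driftOp_nonpos_of_forall_le {a : E → Fin n → Fin n → ℝ} {w : E → ℝ}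
    (ha : ∀ x, (Matrix.of (a x)).PosDef) (hac : ∀ i j, Continuous fun x => a x i j)
    (hw : ContDiff ℝ (⊤ : ℕ∞) w) (hL : ∀ x, driftOp a w x ≤ 0) {x₀ : E}
    (hmin : ∀ y, w x₀ ≤ w y) (y : E) : w y = w x₀ := by
  by_contra hne
  have hcl : IsClosed {x | w x = w x₀} := isClosed_eq hw.continuous continuous_const
  obtain ⟨z, hzZ, hz⟩ := hcl.exists_infDist_eq_dist ⟨x₀, rfl⟩ y
  have hdist : ∀ x, w x = w x₀ → ‖z - y‖ ≤ ‖x - y‖ := fun x hx => by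
    have := Metric.infDist_le_dist_of_mem (x := y) (show x ∈ {x | w x = w x₀} from hx)
    rwa [hz, dist_comm, dist_comm y x, dist_eq_norm, dist_eq_norm] at this
  have hzy : z ≠ y := fun h => hne (h ▸ hzZ)
  set q : E := y + (1 / 2 : ℝ) • (z - y) with hq
  have hzq : z - q = (1 / 2 : ℝ) • (z - y) := by rw [hq]; module
  have hqy : q - y = (1 / 2 : ℝ) • (z - y) := by rw [hq]; module
  have htouch : ∀ x, w x = w x₀ → ‖x - q‖ ≤ ‖z - q‖ → x = z := by
    intro x hx hxq
    have h1 := hdist x hx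
    have h2 := parallelogram_law_with_norm ℝ (x - q) (q - y)
    have h3 : x - q + (q - y) = x - y := by abel
    have h4 : x - q - (q - y) = x - z := by rw [hqy, hq]; module
    rw [h3, h4, hqy] at h2
    rw [hzq] at hxq
    rw [norm_smul] at h2 hxq
    norm_num at h2 hxq
    have h5 : ‖x - z‖ = 0 := by
      nlinarith [norm_nonneg (x - z), norm_nonneg (x - q), norm_nonneg (z - y)]
    exact sub_eq_zero.mp (norm_eq_zero.mp h5)
  have hξ : z - q ≠ 0 := by
    rw [hzq]; exact smul_ne_zero (by norm_num) (sub_ne_zero.mpr hzy)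
  set Q : E → ℝ := fun x => ∑ i, ∑ j, a x i j * (2 * (x i - q i) * (2 * (x j - q j))) with hQ
  have hQz : 0 < Q z := by
    have h := (ha z).dotProduct_mulVec_pos (x := (z - q).ofLp) 
      (by simpa only [ne_eq, WithLp.ofLp_eq_zero] using hξ)
    have : Q z = 4 * (star (z - q).ofLp ⬝ᵥ Matrix.of (a z) *ᵥ (z - q).ofLp) := by
      simp only [hQ, dotProduct, Matrix.mulVec, Finset.mul_sum]
      refine Finset.sum_congr rfl fun i _ => Finset.sum_congr rfl fun j _ => ?_
      simp
      ring
    rw [this]; positivity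
  set d : E → ℝ := fun x => ‖x - q‖ ^ 2 with hd
  have hdsm : ContDiff ℝ (⊤ : ℕ∞) d := contDiff_norm_sub_sq q
  set D : E → ℝ := fun x => 2 * ∑ i, a x i i - ∑ i, x i * (x i - q i) with hD
  have hQc : Continuous Q := by fun_prop
  have hDc : Continuous D := by fun_prop
  set α : ℝ := (|D z| + 1) / Q z with hα
  have hα0 : 0 < α := by positivity
  have hαz : D z < α * Q z := by
    rw [hα, div_mul_cancel₀ _ hQz.ne']
    linarith [le_abs_self (D z)]
  have hev : ∀ᶠ x in 𝓝 z, D x < α * Q x :=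
    hDc.continuousAt.eventually_lt (continuous_const.mul hQc).continuousAt hαz
  obtain ⟨ρ, hρ, hball⟩ := Metric.nhds_basis_closedBall.mem_iff.mp hev
  set b : E → ℝ := fun x => Real.exp (-α * d x) with hb
  have hbsm : ContDiff ℝ (⊤ : ℕ∞) b := (contDiff_const.mul hdsm).exp
  have hLb : ∀ x ∈ Metric.closedBall z ρ, 0 < driftOp a b x := by
    intro x hx
    have hxx : D x < α * Q x := hball hx
    have e : driftOp a b x = α * Real.exp (-α * d x) * (α * Q x - D x) :=
      driftOp_exp_norm_sub_sq a α q x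
    rw [e]
    have := sub_pos.mpr hxx
    positivity
  set β : ℝ := b z with hβ
  have hβ0 : 0 < β := Real.exp_pos _
  have hcomp : IsCompact (Metric.sphere z ρ ∩ Metric.closedBall q ‖z - q‖) :=
    (isCompact_sphere z ρ).inter_right Metric.isClosed_closedBall
  obtain ⟨c, hc, hcle⟩ := hcomp.exists_forall_le' hw.continuous.continuousOn (a := w x₀) (by
    rintro x ⟨hx1, hx2⟩
    refine lt_of_le_of_ne (hmin x) fun h => ?_
    have := htouch x h.symm (by simpa [dist_eq_norm] using hx2)
    subst this
    simp at hx1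
    exact hρ.ne hx1)
  set ε := c - w x₀ with hε
  have hε0 : 0 < ε := sub_pos.mpr hc
  have hψ : ContDiff ℝ (⊤ : ℕ∞) fun x => w x + (-ε) * b x := hw.add (contDiff_const.mul hbsm)
  obtain ⟨m, hmB, hm⟩ := (isCompact_closedBall z ρ).exists_isMinOn
    ⟨z, Metric.mem_closedBall_self hρ.le⟩ hψ.continuous.continuousOn
  have hmz : w m + (-ε) * b m ≤ w x₀ + (-ε) * β := by
    have := hm (Metric.mem_closedBall_self hρ.le)
    simpa [show w z = w x₀ from hzZ] using this
  have hmem : m ∈ Metric.ball z ρ := by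
    by_contra hnot
    have hsph : m ∈ Metric.sphere z ρ :=
      le_antisymm hmB (not_lt.mp hnot)
    by_cases hmq : ‖m - q‖ ≤ ‖z - q‖
    · have h1 : c ≤ w m := hcle m ⟨hsph, by simpa [dist_eq_norm] using hmq⟩
      have h2 : b m ≤ 1 := Real.exp_le_one_iff.mpr (by
        have : 0 ≤ d m := sq_nonneg _
        nlinarith)
      nlinarith [mul_pos hε0 hβ0]
    · push Not at hmq
      have h1 : b m < β := Real.exp_lt_exp.mpr (by
        have : d z < d m := pow_lt_pow_left₀ hmq (norm_nonneg _) two_ne_zero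
        nlinarith)
      nlinarith [hmin m]
  have hloc : IsLocalMin (fun x => w x + (-ε) * b x) m :=
    hm.isLocalMin (Filter.mem_of_superset (Metric.isOpen_ball.mem_nhds hmem)
      Metric.ball_subset_closedBall)
  have h1 := hloc.driftOp_nonneg hψ (ha m).posSemidef
  rw [driftOp_add_const_mul a hw hbsm] at h1
  nlinarith [hL m, mul_pos hε0 (hLb m hmB)]

section Algebra

variable (p : Fin n → ℝ)

lemma posDef_one_sub_vecMulVec :
    (1 - (1 + ∑ k, p k ^ 2)⁻¹ • vecMulVec p p : Matrix (Fin n) (Fin n) ℝ).PosDef := by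
  have hr : 0 ≤ ∑ k, p k ^ 2 := Finset.sum_nonneg fun _ _ => sq_nonneg _
  refine .of_dotProduct_mulVec_pos ?_ fun v hv => ?_
  · ext i j
    simp [vecMulVec_apply, Matrix.one_apply, mul_comm (p i), eq_comm]
  · have hv0 : 0 < ∑ k, v k ^ 2 := by
      obtain ⟨i, hi⟩ := Function.ne_iff.mp hv
      exact Finset.sum_pos' (fun _ _ => sq_nonneg _) ⟨i, Finset.mem_univ _, by
        have : v i ≠ 0 := hi
        positivity⟩
    have hcs := Finset.sum_mul_sq_le_sq_mul_sq Finset.univ p v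
    have e : star v ⬝ᵥ (1 - (1 + ∑ k, p k ^ 2)⁻¹ • vecMulVec p p) *ᵥ v =
        ∑ k, v k ^ 2 - (1 + ∑ k, p k ^ 2)⁻¹ * (∑ k, p k * v k) ^ 2 := by
      rw [sub_mulVec, smul_mulVec, one_mulVec, dotProduct_sub, dotProduct_smul,
        vecMulVec_mulVec]
      simp [dotProduct, sq, Finset.mul_sum, mul_assoc, mul_comm, mul_left_comm]
    rw [e, sub_pos, inv_mul_lt_iff₀ (by positivity)]
    nlinarith

variable {p} {M : Matrix (Fin n) (Fin n) ℝ}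

/-- The right-hand side is `tr (G M G M)` for `G = 1 - p pᵀ / (1 + |p|²)`. -/
lemma hessian_sq_nonneg (hM : M.IsSymm) :
    0 ≤ ∑ i, ∑ j, M i j ^ 2 - 2 * (∑ i, (M *ᵥ p) i ^ 2) / (1 + ∑ k, p k ^ 2)
      + (∑ i, p i * (M *ᵥ p) i) ^ 2 / (1 + ∑ k, p k ^ 2) ^ 2 := by
  set s := 1 + ∑ k, p k ^ 2 with hs
  set G : Matrix (Fin n) (Fin n) ℝ := 1 - s⁻¹ • vecMulVec p p with hG
  have hGp : G.PosSemidef := (posDef_one_sub_vecMulVec p).posSemidef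
  have hvM : p ᵥ* M = M *ᵥ p := by rw [← mulVec_transpose, hM.eq]
  have key : 0 ≤ (G * (M * G * M)).trace := by
    open scoped MatrixOrder Matrix.Norms.L2Operator in
    obtain ⟨B, hB⟩ := CStarAlgebra.nonneg_iff_eq_star_mul_self.mp hGp.nonneg
    have := (hGp.mul_mul_conjTranspose_same (B * M)).trace_nonneg
    rw [conjTranspose_mul, conjTranspose_eq_transpose_of_trivial M, hM.eq] at this
    have e : B * M * G * (M * Bᴴ) = B * (M * G * M) * Bᴴ := by simp only [Matrix.mul_assoc]
    rw [e, trace_mul_cycle] at this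
    rwa [← star_eq_conjTranspose, ← hB] at this
  convert key using 1
  have h1 : (M * M).trace = ∑ i, ∑ j, M i j ^ 2 := by
    simp only [Matrix.trace, Matrix.mul_apply, Matrix.diag]
    exact Finset.sum_congr rfl fun i _ => Finset.sum_congr rfl fun j _ => by
      rw [hM.apply i j, sq]
  have h2 : (vecMulVec p p * (M * M)).trace = ∑ i, (M *ᵥ p) i ^ 2 := by
    rw [vecMulVec_mul, ← vecMul_vecMul, hvM, trace_vecMulVec, dotProduct_comm,
      ← dotProduct_mulVec]
    simp [dotProduct, sq]
  have h3 : (M * vecMulVec p p * M).trace = ∑ i, (M *ᵥ p) i ^ 2 := by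
    rw [mul_vecMulVec, vecMulVec_mul, hvM, trace_vecMulVec]
    simp [dotProduct, sq]
  have h4 : (vecMulVec p p * (M * vecMulVec p p * M)).trace = (∑ i, p i * (M *ᵥ p) i) ^ 2 := by
    rw [mul_vecMulVec, vecMulVec_mul _ p M, hvM, vecMulVec_mul_vecMulVec, trace_vecMulVec,
      dotProduct_smul]
    simp [dotProduct, sq]
  have e : G * (M * G * M) = M * M - s⁻¹ • (vecMulVec p p * (M * M))
      - s⁻¹ • (M * vecMulVec p p * M)
      + s⁻¹ • s⁻¹ • (vecMulVec p p * (M * vecMulVec p p * M)) := by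
    simp only [hG, Matrix.sub_mul, Matrix.mul_sub, Matrix.one_mul, Matrix.mul_one,
      Matrix.smul_mul, Matrix.mul_smul, smul_sub]
    abel
  rw [e, trace_add, trace_sub, trace_sub]
  simp only [trace_smul, h1, h2, h3, h4, smul_eq_mul]
  clear_value G s
  ring

lemma sum_sum_metric_mul (v : Fin n → ℝ) :
    ∑ i, ∑ j, ((if i = j then 1 else 0) - p i * p j / (1 + ∑ k, p k ^ 2)) * (v i * v j) =
      ∑ i, v i ^ 2 - (∑ i, p i * v i) ^ 2 / (1 + ∑ k, p k ^ 2) := by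
  simp only [sub_mul, ite_mul, one_mul, zero_mul, Finset.sum_sub_distrib, Finset.sum_ite_eq,
    Finset.mem_univ, if_true]
  congr 1
  · simp only [sq]
  · rw [sq, Finset.sum_mul_sum, Finset.sum_div]
    refine Finset.sum_congr rfl fun i _ => ?_
    rw [Finset.sum_div]
    exact Finset.sum_congr rfl fun j _ => by ring

lemma sum_sum_sum_metric_mul (hM : M.IsSymm) :
    ∑ k, ∑ i, ∑ j, ((if i = j then 1 else 0) - p i * p j / (1 + ∑ l, p l ^ 2)) * (M i k * M j k) =
      ∑ i, ∑ j, M i j ^ 2 - (∑ i, (M *ᵥ p) i ^ 2) / (1 + ∑ k, p k ^ 2) := by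
  simp only [sum_sum_metric_mul (p := p) (fun i => M i _), Finset.sum_sub_distrib]
  rw [Finset.sum_comm, Finset.sum_div]
  congr 1
  refine Finset.sum_congr rfl fun k _ => ?_
  simp only [mulVec, dotProduct]
  congr 2
  exact Finset.sum_congr rfl fun i _ => by rw [hM.apply k i, mul_comm]

lemma sum_mul_sum_sum_metric_deriv (hM : M.IsSymm) (s : ℝ) :
    ∑ k, p k * ∑ i, ∑ j, (-(M k i * p j + p i * M k j) / s
      + p i * p j * (2 * (M *ᵥ p) k) / s ^ 2) * M i j =
      -2 * (∑ i, (M *ᵥ p) i ^ 2) / s + 2 * (∑ i, p i * (M *ᵥ p) i) ^ 2 / s ^ 2 := by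
  have hcol : ∀ i, ∑ k, p k * M k i = (M *ᵥ p) i := fun i => by
    simp only [mulVec, dotProduct]
    exact Finset.sum_congr rfl fun k _ => by rw [hM.apply i k, mul_comm]
  have hrow : ∀ i, ∑ j, M i j * p j = (M *ᵥ p) i := fun i => rfl
  have h1 : ∑ i, ∑ j, (M *ᵥ p) i * (M i j * p j) = ∑ i, (M *ᵥ p) i ^ 2 := by
    simp only [← Finset.mul_sum, hrow, sq]
  have h2 : ∑ i, ∑ j, (M *ᵥ p) j * (p i * M i j) = ∑ i, (M *ᵥ p) i ^ 2 := by
    rw [Finset.sum_comm]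
    simp only [← Finset.mul_sum, hcol, sq]
  have h3 : ∑ i, ∑ j, p i * (M i j * p j) = ∑ i, p i * (M *ᵥ p) i := by
    simp only [← Finset.mul_sum, hrow]
  have hk : ∀ i j, ∑ k, p k * ((-(M k i * p j + p i * M k j) / s
      + p i * p j * (2 * (M *ᵥ p) k) / s ^ 2) * M i j) =
      -s⁻¹ * ((M *ᵥ p) i * (M i j * p j)) + -s⁻¹ * ((M *ᵥ p) j * (p i * M i j))
        + 2 * (∑ k, p k * (M *ᵥ p) k) / s ^ 2 * (p i * (M i j * p j)) := by
    intro i j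
    have e : ∀ k, p k * ((-(M k i * p j + p i * M k j) / s
      + p i * p j * (2 * (M *ᵥ p) k) / s ^ 2) * M i j) =
      -s⁻¹ * (M i j * p j) * (p k * M k i) + -s⁻¹ * (p i * M i j) * (p k * M k j)
        + 2 / s ^ 2 * (p i * (M i j * p j)) * (p k * (M *ᵥ p) k) := by
      intro k
      ring
    simp only [e, Finset.sum_add_distrib, ← Finset.mul_sum, hcol]
    ring
  conv_lhs => simp only [Finset.mul_sum]
  rw [Finset.sum_comm]
  have hswap : ∀ i, ∑ k, ∑ j, p k * ((-(M k i * p j + p i * M k j) / s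
      + p i * p j * (2 * (M *ᵥ p) k) / s ^ 2) * M i j) = ∑ j, ∑ k, p k *
      ((-(M k i * p j + p i * M k j) / s + p i * p j * (2 * (M *ᵥ p) k) / s ^ 2) * M i j) :=
    fun i => Finset.sum_comm
  simp only [hswap, hk, Finset.sum_add_distrib]
  have hpull : ∀ (c : ℝ) (F : Fin n → Fin n → ℝ),
      ∑ i, ∑ j, c * F i j = c * ∑ i, ∑ j, F i j := fun c F => by simp only [Finset.mul_sum]
  rw [hpull, hpull, hpull, h1, h2, h3]
  ring

end Algebra

section SelfShrinker

variable {f : EuclideanSpace ℝ (Fin n) → ℝ}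

lemma one_add_sum_pd_sq_pos (f : E → ℝ) (x : E) : 0 < 1 + ∑ k, pd f k x ^ 2 :=
  add_pos_of_pos_of_nonneg one_pos (Finset.sum_nonneg fun _ _ => sq_nonneg _)

lemma posDef_gInv (f : E → ℝ) (x : E) : (Matrix.of fun i j => gInv f i j x).PosDef := by
  convert posDef_one_sub_vecMulVec (fun i => pd f i x) using 1
  ext i j
  simp [gInv, vecMulVec_apply, Matrix.one_apply, div_eq_inv_mul]

lemma sum_gInv_self_le (f : E → ℝ) (x : E) : ∑ i, gInv f i i x ≤ n := by
  have h : ∀ i, gInv f i i x ≤ 1 := fun i => by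
    have : 0 ≤ pd f i x * pd f i x / (1 + ∑ k, pd f k x ^ 2) :=
      div_nonneg (mul_self_nonneg _) (one_add_sum_pd_sq_pos f x).le
    simpa [gInv] using this
  simpa using Finset.sum_le_sum fun i (_ : i ∈ Finset.univ) => h i

lemma continuous_gInv (hf : ContDiff ℝ (⊤ : ℕ∞) f) (i j : Fin n) : Continuous (gInv f i j) := by
  have h := fun k => (contDiff_pd hf k).continuous
  unfold gInv
  exact continuous_const.sub (((h i).mul (h j)).div
    (continuous_const.add (continuous_finsetSum _ fun k _ => (h k).pow 2))
    fun x => (one_add_sum_pd_sq_pos f x).ne')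

/-- The Hessian matrix. -/
noncomputable def hessian (f : E → ℝ) (x : E) : Matrix (Fin n) (Fin n) ℝ :=
  Matrix.of fun i j => pd2 f i j x

lemma isSymm_hessian (hf : ContDiff ℝ (⊤ : ℕ∞) f) (x : E) : (hessian f x).IsSymm :=
  Matrix.IsSymm.ext fun i j => pd2_comm hf j i x

lemma hasDerivAt_gInv (hf : ContDiff ℝ (⊤ : ℕ∞) f) (i j k : Fin n) (x : E) :
    HasDerivAt (fun t : ℝ => gInv f i j (x + t • EuclideanSpace.single k 1))
      (-(hessian f x k i * pd f j x + pd f i x * hessian f x k j) / (1 + ∑ l, pd f l x ^ 2)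
        + pd f i x * pd f j x * (2 * (hessian f x *ᵥ fun l => pd f l x) k)
          / (1 + ∑ l, pd f l x ^ 2) ^ 2) 0 := by
  have h : ∀ l, HasDerivAt (fun t : ℝ => pd f l (x + t • EuclideanSpace.single k 1))
      (hessian f x k l) 0 := fun l => hasDerivAt_pd ((contDiff_pd hf l).differentiableAt_of_top x) k
  have hs : HasDerivAt (fun t : ℝ => 1 + ∑ l, pd f l (x + t • EuclideanSpace.single k 1) ^ 2)
      (2 * (hessian f x *ᵥ fun l => pd f l x) k) 0 := by
    refine ((HasDerivAt.fun_sum fun l (_ : l ∈ Finset.univ) =>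
      (h l).fun_pow 2).const_add 1).congr_deriv ?_
    simp only [mulVec, dotProduct, Finset.mul_sum]
    refine Finset.sum_congr rfl fun l _ => ?_
    simp
    ring
  have hs0 := (one_add_sum_pd_sq_pos f x).ne'
  refine ((((h i).fun_mul (h j)).fun_div hs (by simpa using hs0)).const_sub
    (if i = j then 1 else 0)).congr_deriv ?_
  simp only [zero_smul, add_zero]
  field_simp
  ring

/-- Differentiating `g^{ij} ∂²_{ij} f = ½ (x · ∇f - f)` in the direction `e_k`. -/
lemma driftOp_pd (hf : ContDiff ℝ (⊤ : ℕ∞) f)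
    (heq : ∀ x, ∑ i, ∑ j, gInv f i j x * pd2 f i j x
      = (1 / 2) * ((∑ i, x i * pd f i x) - f x)) (k : Fin n) (x : E) :
    driftOp (fun x i j => gInv f i j x) (pd f k) x = -∑ i, ∑ j,
      (-(hessian f x k i * pd f j x + pd f i x * hessian f x k j) / (1 + ∑ l, pd f l x ^ 2)
        + pd f i x * pd f j x * (2 * (hessian f x *ᵥ fun l => pd f l x) k)
          / (1 + ∑ l, pd f l x ^ 2) ^ 2) * hessian f x i j := by
  have hpd3 : ∀ i j, pd (pd2 f i j) k x = pd2 (pd f k) i j x := by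
    intro i j
    have h1 : pd (pd f j) k = pd (pd f k) j := funext fun y => pd2_comm hf k j y
    have h2 : pd (pd2 f i j) k x = pd2 (pd f j) i k x := pd2_comm (contDiff_pd hf j) k i x
    rw [h2]
    exact congrArg (fun φ => pd φ i x) h1
  have hl := HasDerivAt.fun_sum fun i (_ : i ∈ Finset.univ) =>
    HasDerivAt.fun_sum fun j (_ : j ∈ Finset.univ) => (hasDerivAt_gInv hf i j k x).fun_mul
      (hasDerivAt_pd ((contDiff_pd (contDiff_pd hf j) i).differentiableAt_of_top x) k)
  have hcoord : ∀ i, HasDerivAt (fun t : ℝ => (x + t • EuclideanSpace.single k (1 : ℝ)) i)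
      (if i = k then 1 else 0) 0 := fun i => by
    simpa [Pi.single_apply] using
      ((hasDerivAt_id (0 : ℝ)).mul_const (if i = k then (1 : ℝ) else 0)).const_add (x i)
  have hr := ((HasDerivAt.fun_sum fun i (_ : i ∈ Finset.univ) => (hcoord i).fun_mul
    (hasDerivAt_pd ((contDiff_pd hf i).differentiableAt_of_top x) k)).fun_sub
      (hasDerivAt_pd (hf.differentiableAt_of_top x) k)).const_mul (1 / 2)
  have huniq := hl.unique (hr.congr_of_eventuallyEq (Eventually.of_forall fun t => heq _))
  have hsymm : ∀ i, pd (pd f i) k x = pd (pd f k) i x := fun i => pd2_comm hf k i x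
  have hM : ∀ i j, pd (pd f j) i x = hessian f x i j := fun i j => rfl
  have hpd3' : ∀ i j, pd (pd (pd f j) i) k x = pd2 (pd f k) i j x := hpd3
  simp only [zero_smul, add_zero, hpd3', hsymm, Finset.sum_add_distrib, ite_mul, one_mul, zero_mul,
    Finset.sum_ite_eq', Finset.mem_univ, if_true] at huniq
  simp only [driftOp]
  simp only [hM] at huniq ⊢
  linarith

lemma driftOp_sum_pd_sq (hf : ContDiff ℝ (⊤ : ℕ∞) f)
    (heq : ∀ x, ∑ i, ∑ j, gInv f i j x * pd2 f i j x
      = (1 / 2) * ((∑ i, x i * pd f i x) - f x)) (x : E) :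
    driftOp (fun x i j => gInv f i j x) (fun y => ∑ k, pd f k y ^ 2) x =
      2 * ∑ i, ∑ j, hessian f x i j ^ 2
      + 2 * (∑ i, (hessian f x *ᵥ fun l => pd f l x) i ^ 2) / (1 + ∑ k, pd f k x ^ 2)
      - 4 * (∑ i, pd f i x * (hessian f x *ᵥ fun l => pd f l x) i) ^ 2
        / (1 + ∑ k, pd f k x ^ 2) ^ 2 := by
  have hM := isSymm_hessian hf x
  rw [driftOp_sum _ _ fun k => (contDiff_pd hf k).pow 2]
  have hk : ∀ k, driftOp (fun x i j => gInv f i j x) (fun y => pd f k y ^ 2) x =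
      2 * (pd f k x * driftOp (fun x i j => gInv f i j x) (pd f k) x) +
      2 * ∑ i, ∑ j, gInv f i j x * (hessian f x i k * hessian f x j k) := by
    intro k
    rw [driftOp_comp _ (F := fun t => t ^ 2) (F' := fun t => 2 * t) (F'' := 2) (contDiff_pd hf k)
      (fun y => by simpa using hasDerivAt_pow 2 (pd f k y))
      (by simpa using (hasDerivAt_id (pd f k x)).const_mul 2)]
    rw [mul_assoc]
    rfl
  simp only [hk, Finset.sum_add_distrib, ← Finset.mul_sum, driftOp_pd hf heq, mul_neg,
    Finset.sum_neg_distrib]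
  have h1 := sum_mul_sum_sum_metric_deriv (p := fun l => pd f l x) hM (1 + ∑ l, pd f l x ^ 2)
  have h2 := sum_sum_sum_metric_mul (p := fun l => pd f l x) hM
  simp only [gInv]
  rw [h1, h2]
  ring

lemma pd_sum_pd_sq (hf : ContDiff ℝ (⊤ : ℕ∞) f) (i : Fin n) (x : E) :
    pd (fun y => ∑ k, pd f k y ^ 2) i x = 2 * (hessian f x *ᵥ fun l => pd f l x) i := by
  have hsm : ContDiff ℝ (⊤ : ℕ∞) fun y => ∑ k, pd f k y ^ 2 :=
    ContDiff.sum fun k _ => (contDiff_pd hf k).pow 2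
  refine pd_eq_of_hasDerivAt (hsm.differentiableAt_of_top x) ?_
  refine (HasDerivAt.fun_sum fun l (_ : l ∈ Finset.univ) =>
    (hasDerivAt_pd ((contDiff_pd hf l).differentiableAt_of_top x) i).fun_pow 2).congr_deriv ?_
  simp only [mulVec, dotProduct, Finset.mul_sum]
  refine Finset.sum_congr rfl fun l _ => ?_
  simp [hessian, pd2]
  ring

/-- The angle function `(1 + |∇f|²)^{-1/2}` is a supersolution of the drift Laplacian. -/
lemma driftOp_angle_nonpos (hf : ContDiff ℝ (⊤ : ℕ∞) f)
    (heq : ∀ x, ∑ i, ∑ j, gInv f i j x * pd2 f i j x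
      = (1 / 2) * ((∑ i, x i * pd f i x) - f x)) (x : E) :
    driftOp (fun x i j => gInv f i j x)
      (fun y => (1 + ∑ k, pd f k y ^ 2) ^ (-1 / 2 : ℝ)) x ≤ 0 := by
  have hsm : ContDiff ℝ (⊤ : ℕ∞) fun y => ∑ k, pd f k y ^ 2 :=
    ContDiff.sum fun k _ => (contDiff_pd hf k).pow 2
  have hrpow : ∀ (r : ℝ) (y : E), HasDerivAt (fun t : ℝ => (1 + t) ^ r)
      (r * (1 + ∑ k, pd f k y ^ 2) ^ (r - 1)) (∑ k, pd f k y ^ 2) := fun r y => by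
    simpa using ((hasDerivAt_id (∑ k, pd f k y ^ 2)).const_add 1).rpow_const (p := r)
      (Or.inl (one_add_sum_pd_sq_pos f y).ne')
  rw [driftOp_comp _ (F := fun t => (1 + t) ^ (-1 / 2 : ℝ))
    (F' := fun t => (-1 / 2) * (1 + t) ^ (-1 / 2 - 1 : ℝ)) hsm (hrpow _)
    ((hrpow _ x).const_mul (-1 / 2)), driftOp_sum_pd_sq hf heq]
  simp only [pd_sum_pd_sq hf]
  have hgrad := sum_sum_metric_mul (p := fun l => pd f l x)
    (fun i => 2 * (hessian f x *ᵥ fun l => pd f l x) i)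
  simp only [gInv]
  rw [hgrad]
  have hsq := hessian_sq_nonneg (p := fun l => pd f l x) (isSymm_hessian hf x)
  have hs := one_add_sum_pd_sq_pos f x
  simp only [mul_pow, mul_left_comm _ (2 : ℝ), ← Finset.mul_sum]
  generalize ∑ i, (hessian f x *ᵥ fun l => pd f l x) i ^ 2 = A at hsq ⊢
  generalize ∑ i, pd f i x * (hessian f x *ᵥ fun l => pd f l x) i = q at hsq ⊢
  generalize ∑ i, ∑ j, hessian f x i j ^ 2 = B at hsq ⊢
  generalize 1 + ∑ k, pd f k x ^ 2 = s at hs hsq ⊢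
  have hpow : s ^ (-1 / 2 - 1 : ℝ) = s ^ (-1 / 2 - 1 - 1 : ℝ) * s := by
    rw [← Real.rpow_add_one hs.ne']
    norm_num
  have hfin : -1 / 2 * s ^ (-1 / 2 - 1 : ℝ) * (2 * B + 2 * A / s - 4 * q ^ 2 / s ^ 2) +
      -1 / 2 * ((-1 / 2 - 1) * s ^ (-1 / 2 - 1 - 1 : ℝ)) *
        (2 ^ 2 * A - 2 ^ 2 * q ^ 2 / s) =
      -(s ^ (-1 / 2 - 1 - 1 : ℝ) * s * (B - 2 * A / s + q ^ 2 / s ^ 2)) := by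
    rw [hpow]
    field_simp
    ring
  rw [hfin]
  exact neg_nonpos.mpr (mul_nonneg (mul_nonneg (Real.rpow_nonneg hs.le _) hs.le) hsq)

end SelfShrinker

end Calculus

/-- On an entire graphical self-shrinker, the gradient has constant norm; equivalently the
vertical component `w = (1 + |∇f|²)^{−1/2}` of the upward unit normal is constant. -/
theorem entire_graphical_self_shrinker_gradient_norm_constant
    (n : ℕ) (hn : 1 ≤ n) (f : EuclideanSpace ℝ (Fin n) → ℝ)
    (hf : ContDiff ℝ (⊤ : ℕ∞) f)
    (heq : ∀ x, ∑ i, ∑ j, gInv f i j x * pd2 f i j x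
      = (1 / 2) * ((∑ i, x i * pd f i x) - f x)) :
    ∃ c : ℝ, ∀ x, Real.sqrt (∑ i, (pd f i x) ^ 2) = c := by
  set w : EuclideanSpace ℝ (Fin n) → ℝ := fun y => (1 + ∑ k, pd f k y ^ 2) ^ (-1 / 2 : ℝ) with hw
  have hwsm : ContDiff ℝ (⊤ : ℕ∞) w :=
    (contDiff_const.add (ContDiff.sum fun k _ => (contDiff_pd hf k).pow 2)).rpow_const_of_ne
      fun y => (one_add_sum_pd_sq_pos f y).ne'
  have hL := driftOp_angle_nonpos hf heq
  obtain ⟨x₀, hx₀⟩ := exists_forall_le_of_driftOp_nonpos (fun x => (posDef_gInv f x).posSemidef)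
    (sum_gInv_self_le f) hwsm (fun x => Real.rpow_nonneg (one_add_sum_pd_sq_pos f x).le _) hL
  refine ⟨Real.sqrt (∑ i, pd f i x₀ ^ 2), fun x => ?_⟩
  have h : w x = w x₀ :=
    eq_of_driftOp_nonpos_of_forall_le (posDef_gInv f) (continuous_gInv hf) hwsm hL hx₀ x
  have h' := (Real.rpow_left_inj (one_add_sum_pd_sq_pos f x).le (one_add_sum_pd_sq_pos f x₀).le
    (by norm_num)).mp h
  rw [add_left_cancel h']
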